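/- For the Grover-coin discrete-time coined quantum walk on a finite group G with generating set S started from the basis state (s*, g*), the amplitudes are given by: for every t ≥ 1, s ∈ S and g ∈ G, α_{s,t}(g) = ∑_{k=0}^{t−1} a^{t−k−1} b^k · ( a·#_{k,t,s,+s*}(g*⁻¹ g) + b·#_{k,t,s,−s*}(g*⁻¹ g) ). -/

import Mathlib

/-- `wordSet S n k s` is the set `R_{k,n+1,s}` of words `w = (w_1, …, w_{n+1})` over the
generating set `S` whose last letter is `s` and which have exactly `k` adjacent indices `i`
with `w_i ≠ w_{i+1}`. -/
def wordSet {G : Type} [Group G] [Fintype G] [DecidableEq G]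
    (S : Finset G) (n k : ℕ) (s : G) : Finset (Fin (n + 1) → G) :=
  Finset.univ.filter fun w =>
    (∀ i, w i ∈ S) ∧ w (Fin.last n) = s ∧
      (Finset.univ.filter fun i : Fin n => w i.castSucc ≠ w i.succ).card = k

/-- `#_{k,n+1,s,+s*}(g)`: the number of words in `R_{k,n+1,s}` with first letter `s*` and
product `g`. -/
def pathCountFirst {G : Type} [Group G] [Fintype G] [DecidableEq G]
    (S : Finset G) (n k : ℕ) (s sStar g : G) : ℕ :=
  ((wordSet S n k s).filter fun w => w 0 = sStar ∧ (List.ofFn w).prod = g).card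

/-- `#_{k,n+1,s,−s*}(g)`: the number of words in `R_{k,n+1,s}` with first letter `≠ s*` and
product `g`. -/
def pathCountNotFirst {G : Type} [Group G] [Fintype G] [DecidableEq G]
    (S : Finset G) (n k : ℕ) (s sStar g : G) : ℕ :=
  ((wordSet S n k s).filter fun w => w 0 ≠ sStar ∧ (List.ofFn w).prod = g).card

/-- The amplitude contributed by a word `w`: a factor `a` or `b` for each adjacent pair of equal or
distinct letters, and for the first letter according to whether it is `x`. -/
noncomputable def wordWeight {G : Type} [DecidableEq G] (a b : ℂ) (x : G) {n : ℕ}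
    (w : Fin (n + 1) → G) : ℂ :=
  (∏ i : Fin n, if w i.castSucc ≠ w i.succ then b else a) * if w 0 = x then a else b

/-- The total weight of the words over `S` of length `n + 1` with last letter `s` and
product `g`. -/
noncomputable def wordWeightSum {G : Type} [Group G] [Fintype G] [DecidableEq G] (S : Finset G)
    (a b : ℂ) (x : G) (n : ℕ) (s g : G) : ℂ :=
  ∑ w : Fin (n + 1) → G,
    if (∀ i, w i ∈ S) ∧ w (Fin.last n) = s ∧ (List.ofFn w).prod = g then
      wordWeight a b x w else 0

theorem wordWeight_eq_pow {G : Type} [DecidableEq G] (a b : ℂ) (x : G) {n : ℕ}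
    (w : Fin (n + 1) → G) :
    wordWeight a b x w =
      a ^ (n - (Finset.univ.filter fun i : Fin n => w i.castSucc ≠ w i.succ).card) *
        b ^ (Finset.univ.filter fun i : Fin n => w i.castSucc ≠ w i.succ).card *
          if w 0 = x then a else b := by
  have h := Finset.card_filter_add_card_filter_not (s := (Finset.univ : Finset (Fin n)))
    (fun i : Fin n => w i.castSucc ≠ w i.succ)
  rw [Finset.card_univ, Fintype.card_fin] at h
  rw [wordWeight, Finset.prod_ite, Finset.prod_const, Finset.prod_const, ← Nat.eq_sub_of_add_eq' h,
    mul_comm (b ^ _)]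

theorem wordWeightSum_eq_sum_pathCount {G : Type} [Group G] [Fintype G] [DecidableEq G]
    (S : Finset G) (a b : ℂ) (x : G) (n : ℕ) (s g : G) :
    wordWeightSum S a b x n s g =
      ∑ k ∈ Finset.range (n + 1), a ^ (n - k) * b ^ k *
        (a * (pathCountFirst S n k s x g : ℂ) + b * (pathCountNotFirst S n k s x g : ℂ)) := by
  have key : ∀ k, a ^ (n - k) * b ^ k *
        (a * (pathCountFirst S n k s x g : ℂ) + b * (pathCountNotFirst S n k s x g : ℂ)) =
      ∑ w : Fin (n + 1) → G,
        if (Finset.univ.filter fun i : Fin n => w i.castSucc ≠ w i.succ).card = k then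
          (if (∀ i, w i ∈ S) ∧ w (Fin.last n) = s ∧ (List.ofFn w).prod = g then
            wordWeight a b x w else 0) else 0 := by
    intro k
    simp only [pathCountFirst, pathCountNotFirst, wordSet, Finset.filter_filter,
      Finset.natCast_card_filter, Finset.mul_sum, ← Finset.sum_add_distrib, wordWeight_eq_pow]
    refine Finset.sum_congr rfl fun w _ => ?_
    by_cases hk : (Finset.univ.filter fun i : Fin n => w i.castSucc ≠ w i.succ).card = k
    · rw [if_pos hk]
      simp only [hk]
      by_cases h0 : w 0 = x <;> by_cases h1 : ∀ i, w i ∈ S <;>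
        by_cases h2 : w (Fin.last n) = s <;> simp [h0, h1, h2]
    · simp [hk]
  simp only [key]
  rw [Finset.sum_comm]
  refine Finset.sum_congr rfl fun w _ => ?_
  rw [Finset.sum_ite_eq]
  refine (if_pos ?_).symm
  rw [Finset.mem_range, Nat.lt_succ_iff]
  exact (Finset.card_le_univ _).trans_eq (Fintype.card_fin n)

theorem wordWeight_snoc {G : Type} [DecidableEq G] (a b : ℂ) (x : G) {n : ℕ}
    (v : Fin (n + 1) → G) (y : G) :
    wordWeight a b x (Fin.snoc v y : Fin (n + 2) → G) =
      (if v (Fin.last n) ≠ y then b else a) * wordWeight a b x v := by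
  have h0 : (Fin.snoc v y : Fin (n + 2) → G) 0 = v 0 :=
    Fin.snoc_castSucc (α := fun _ => G) y v 0
  simp only [wordWeight, Fin.prod_univ_castSucc, Fin.succ_castSucc, Fin.succ_last,
    Fin.snoc_castSucc, Fin.snoc_last, h0]
  ring

theorem wordWeightSum_succ {G : Type} [Group G] [Fintype G] [DecidableEq G]
    (S : Finset G) (a b : ℂ) (x : G) (n : ℕ) {s : G} (hs : s ∈ S) (g : G) :
    wordWeightSum S a b x (n + 1) s g =
      a * wordWeightSum S a b x n s (g * s⁻¹) +
        b * ∑ s' ∈ S.erase s, wordWeightSum S a b x n s' (g * s⁻¹) := by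
  have hsplit : a * wordWeightSum S a b x n s (g * s⁻¹) +
        b * ∑ s' ∈ S.erase s, wordWeightSum S a b x n s' (g * s⁻¹) =
      ∑ s' ∈ S, (if s' ≠ s then b else a) * wordWeightSum S a b x n s' (g * s⁻¹) := by
    rw [← Finset.add_sum_erase _ _ hs, Finset.mul_sum]
    congr 1
    · simp
    · exact Finset.sum_congr rfl fun s' h => by rw [if_pos (Finset.ne_of_mem_erase h)]
  rw [hsplit]
  simp only [wordWeightSum, Finset.mul_sum]
  rw [Finset.sum_comm, ← (Fin.snocEquiv fun _ : Fin (n + 2) => G).sum_comp,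
    Fintype.sum_prod_type_right]
  refine Finset.sum_congr rfl fun v _ => ?_
  have hprod : ∀ y : G, (List.ofFn (Fin.snoc v y : Fin (n + 2) → G)).prod =
      (List.ofFn v).prod * y := fun y => by
    rw [List.ofFn_succ', List.concat_eq_append, List.prod_append]
    simp
  have hmem : ∀ y : G, (∀ i, (Fin.snoc v y : Fin (n + 2) → G) i ∈ S) ↔ (∀ i, v i ∈ S) ∧ y ∈ S :=
    fun y => by
      rw [Fin.forall_fin_succ']
      simp
  have hsnoc : ∀ y : G, (Fin.snocEquiv fun _ : Fin (n + 2) => G) (y, v) = Fin.snoc v y :=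
    fun _ => rfl
  simp only [hsnoc, wordWeight_snoc, hprod, hmem, Fin.snoc_last]
  by_cases hv : (∀ i, v i ∈ S) ∧ (List.ofFn v).prod = g * s⁻¹
  · rw [Finset.sum_eq_single s, Finset.sum_eq_single (v (Fin.last n))]
    · rw [if_pos ⟨⟨hv.1, hs⟩, rfl, hv.2 ▸ inv_mul_cancel_right g s⟩,
        if_pos (c := _ ∧ _) ⟨hv.1, rfl, hv.2⟩]
    · intro y _ hy
      simp [hy.symm]
    · exact fun h => absurd (hv.1 _) h
    · intro y _ hy
      simp [hy]
    · simp
  · rw [Finset.sum_eq_zero, Finset.sum_eq_zero]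
    · intro y _
      exact mul_eq_zero_of_right _ (if_neg fun h => hv ⟨h.1, h.2.2⟩)
    · intro y _
      refine if_neg ?_
      rintro ⟨⟨h1, -⟩, rfl, h3⟩
      exact hv ⟨h1, eq_mul_inv_of_mul_eq h3⟩

theorem wordWeightSum_zero {G : Type} [Group G] [Fintype G] [DecidableEq G]
    (S : Finset G) (a b : ℂ) (x : G) {s : G} (hs : s ∈ S) (g : G) :
    wordWeightSum S a b x 0 s g = if s = g then (if s = x then a else b) else 0 := by
  rw [wordWeightSum, ← (Equiv.funUnique (Fin 1) G).symm.sum_comp, Finset.sum_eq_single s]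
  · simp [wordWeight, hs]
  · intro y _ hy
    simp [hy]
  · simp

/-- For the Grover-coin discrete-time coined quantum walk on a finite group
`G` with generating set `S` started from the basis state `(s*, g*)`, the amplitudes are given
by: for every `t ≥ 1` (here `t + 1`), `s ∈ S` and `g ∈ G`,
`α_{s,t}(g) = ∑_{k=0}^{t−1} a^{t−k−1} b^k (a·#_{k,t,s,+s*}(g*⁻¹g) + b·#_{k,t,s,−s*}(g*⁻¹g))`. -/
theorem grover_walk_basis_state_amplitude
    {G : Type} [Group G] [Fintype G] [DecidableEq G]
    (S : Finset G) (hgen : Subgroup.closure (S : Set G) = ⊤) (hd : 3 ≤ S.card)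
    (a b : ℝ) (ha : a = 2 / S.card - 1) (hb : b = 2 / S.card)
    (sStar : G) (hsStar : sStar ∈ S) (gStar : G)
    (α : G → ℕ → G → ℂ)
    (hinit : ∀ s ∈ S, ∀ g : G,
      α s 0 g = if s = sStar ∧ g = gStar then 1 else 0)
    (hrec : ∀ s ∈ S, ∀ t : ℕ, ∀ g : G,
      α s (t + 1) g =
        (a : ℂ) * α s t (g * s⁻¹) + (b : ℂ) * ∑ s' ∈ S.erase s, α s' t (g * s⁻¹))
    (t : ℕ) (s : G) (hs : s ∈ S) (g : G) :
    α s (t + 1) g =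
      ∑ k ∈ Finset.range (t + 1),
        (a : ℂ) ^ (t - k) * (b : ℂ) ^ k *
          ((a : ℂ) * (pathCountFirst S t k s sStar (gStar⁻¹ * g) : ℂ) +
            (b : ℂ) * (pathCountNotFirst S t k s sStar (gStar⁻¹ * g) : ℂ)) := by
  rw [← wordWeightSum_eq_sum_pathCount]
  induction t generalizing s g with
  | zero =>
    rw [hrec s hs, wordWeightSum_zero S _ _ _ hs, hinit s hs,
      Finset.sum_congr rfl fun s' h => hinit s' (Finset.mem_of_mem_erase h) _]
    have hg : g * s⁻¹ = gStar ↔ s = gStar⁻¹ * g := by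
      rw [mul_inv_eq_iff_eq_mul, eq_inv_mul_iff_mul_eq, eq_comm]
    by_cases h : s = gStar⁻¹ * g
    · rw [if_pos h, hg.2 h]
      by_cases hx : s = sStar
      · subst hx
        simp
      · simp [hx, Ne.symm hx, hsStar]
    · simp [hg, h]
  | succ n ih =>
    rw [hrec s hs, wordWeightSum_succ S _ _ _ n hs, mul_assoc gStar⁻¹, ih s hs,
      Finset.sum_congr rfl fun s' h => ih s' (Finset.mem_of_mem_erase h) _]
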